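/- The language Pal = {w w^R : w ∈ {0,1}*} of even-length palindromes over {0,1} (where w^R denotes the reverse of w) is context-free, its complement is context-free, but Pal does not belong to DCFL[ω]; that is, for every integer d ≥ 1, Pal ∉ DCFL[d]. -/

import Mathlib

/-!
Formalization of one-way deterministic pushdown automata (1dpda) following
Yamakami, "Intersection and Union Hierarchies of Deterministic Context-Free
Languages and Pumping Lemmas".
-/

namespace DCFLFormal

/-- Tape symbols: the left endmarker ¢, the right endmarker $, and input symbols. -/
inductive TSym (α : Type) : Type
  | lend : TSym α
  | rend : TSym α
  | ch : α → TSym α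

/-- A one-way deterministic pushdown automaton (1dpda).  `δ q (some t) a` is the
transition reading the tape symbol `t` with top stack symbol `a`; `δ q none a`
is the ε-transition.  The value `some (p, w)` means: change state to `p` and
replace the topmost stack symbol by the string `w`. -/
structure DPDA (Q α Γ : Type) where
  δ : Q → Option (TSym α) → Γ → Option (Q × List Γ)
  q0 : Q
  Z0 : Γ
  Acc : Set Q
  Rej : Set Q

/-- A configuration: current state, remaining (unread) tape, and stack content
(topmost symbol first, the bottom marker last). -/
structure Cfg (Q α Γ : Type) where
  st : Q
  inp : List (TSym α)
  stk : List Γ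

namespace DPDA

variable {Q α Γ : Type}

/-- Halting (accepting or rejecting) states. -/
def IsHalting (M : DPDA Q α Γ) (q : Q) : Prop := q ∈ M.Acc ∨ q ∈ M.Rej

/-- One step of the machine: an ε-move if one is defined, otherwise read the
next tape symbol; the head moves right exactly when a tape symbol is read. -/
def step (M : DPDA Q α Γ) (c : Cfg Q α Γ) : Option (Cfg Q α Γ) :=
  match c.stk with
  | [] => none
  | a :: s =>
    match M.δ c.st none a with
    | some (p, w) => some ⟨p, c.inp, w ++ s⟩
    | none =>
      match c.inp with
      | [] => none
      | t :: rest =>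
        match M.δ c.st (some t) a with
        | some (p, w) => some ⟨p, rest, w ++ s⟩
        | none => none

/-- Iterated steps. -/
def stepN (M : DPDA Q α Γ) : ℕ → Cfg Q α Γ → Option (Cfg Q α Γ)
  | 0, c => some c
  | n + 1, c => (M.step c).bind (M.stepN n)

/-- The tape holding ¢ x $. -/
def tape (x : List α) : List (TSym α) :=
  TSym.lend :: x.map TSym.ch ++ [TSym.rend]

/-- The initial configuration on input `x`. -/
def init (M : DPDA Q α Γ) (x : List α) : Cfg Q α Γ := ⟨M.q0, tape x, [M.Z0]⟩

/-- `M` accepts `x`: the computation reaches an accepting state. -/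
def Accepts (M : DPDA Q α Γ) (x : List α) : Prop :=
  ∃ n c, M.stepN n (M.init x) = some c ∧ c.st ∈ M.Acc

/-- `M` rejects `x`: the computation reaches a rejecting state. -/
def Rejects (M : DPDA Q α Γ) (x : List α) : Prop :=
  ∃ n c, M.stepN n (M.init x) = some c ∧ c.st ∈ M.Rej

/-- `M` halts (in an accepting or rejecting state) on every input. -/
def HaltsOnAll (M : DPDA Q α Γ) : Prop :=
  ∀ x : List α, ∃ n c, M.stepN n (M.init x) = some c ∧ M.IsHalting c.st

/-- The language recognized by `M`. -/
def lang (M : DPDA Q α Γ) : Set (List α) := {x | M.Accepts x}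

/-- Well-formedness of a 1dpda: accepting and rejecting states are disjoint,
halting states have no outgoing transitions, for every non-halting state,
stack symbol and (non-empty) tape symbol exactly one of the symbol- and the
ε-transition is defined, and the bottom marker Z₀ is never removed. -/
def Valid (M : DPDA Q α Γ) : Prop :=
  (∀ q, q ∈ M.Acc → q ∉ M.Rej) ∧
  (∀ q, M.IsHalting q → ∀ σ a, M.δ q σ a = none) ∧
  (∀ q, ¬ M.IsHalting q → ∀ σ a, ((M.δ q (some σ) a).isSome ↔ M.δ q none a = none)) ∧
  (∀ q σ p w, M.δ q σ M.Z0 = some (p, w) → w ≠ [])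

end DPDA

/-- A language is deterministic context-free if it is recognized by some 1dpda
(with finitely many states and stack symbols) that halts on all inputs. -/
def IsDCFL {α : Type} (L : Set (List α)) : Prop :=
  ∃ (Q Γ : Type) (_ : Fintype Q) (_ : Fintype Γ) (M : DPDA Q α Γ),
    M.Valid ∧ M.HaltsOnAll ∧ L = M.lang

/-- `DCFL(d)`: intersections of `d` dcf languages. -/
def DCFLInter {α : Type} (d : ℕ) (L : Set (List α)) : Prop :=
  ∃ f : Fin d → Set (List α), (∀ i, IsDCFL (f i)) ∧ L = ⋂ i, f i

/-- `DCFL[d]`: unions of `d` dcf languages. -/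
def DCFLUnion {α : Type} (d : ℕ) (L : Set (List α)) : Prop :=
  ∃ f : Fin d → Set (List α), (∀ i, IsDCFL (f i)) ∧ L = ⋃ i, f i

/-- `rep x i` is the string `x` repeated `i` times. -/
def rep {α : Type} (x : List α) (i : ℕ) : List α := (List.replicate i x).flatten

/-- `(x, y)` is an iterative pair of the string `u ++ x ++ v ++ y ++ z` for `L`. -/
def IterPair {α : Type} (L : Set (List α)) (u x v y z : List α) : Prop :=
  1 ≤ (x ++ y).length ∧ ∀ i : ℕ, u ++ rep x i ++ v ++ rep y i ++ z ∈ L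

/-- A nondegenerate iterative pair: either `{u xⁱ v yʲ z ∈ L : j ≥ 0}` is finite
for each `i`, or `{u xⁱ v yʲ z ∈ L : i ≥ 0}` is finite for each `j`. -/
def NonDegIterPair {α : Type} (L : Set (List α)) (u x v y z : List α) : Prop :=
  IterPair L u x v y z ∧
  ((∀ i : ℕ, {s | s ∈ L ∧ ∃ j : ℕ, s = u ++ rep x i ++ v ++ rep y j ++ z}.Finite) ∨
   (∀ j : ℕ, {s | s ∈ L ∧ ∃ i : ℕ, s = u ++ rep x i ++ v ++ rep y j ++ z}.Finite))


/-- The language of even-length palindromes over `{0,1}`. -/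
def Pal : Set (List Bool) := {s | ∃ w : List Bool, s = w ++ w.reverse}

theorem mem_Pal_iff (s : List Bool) : s ∈ Pal ↔ s.reverse = s ∧ Even s.length := by
  constructor
  · rintro ⟨w, rfl⟩
    simp
  · rintro ⟨h, n, hn⟩
    refine ⟨s.take n, ?_⟩
    have h1 : (s.take n).reverse = s.drop n := by
      rw [List.reverse_take, h, hn, Nat.add_sub_cancel]
    rw [h1, List.take_append_drop]

theorem cons_append_singleton_mem_Pal_iff (a b : Bool) (l : List Bool) :
    a :: (l ++ [b]) ∈ Pal ↔ a = b ∧ l ∈ Pal := by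
  simp only [mem_Pal_iff, List.reverse_cons, List.reverse_append, List.length_cons,
    List.length_append, List.reverse_nil, List.length_nil, List.nil_append, List.cons_append,
    List.cons.injEq]
  constructor
  · rintro ⟨⟨rfl, h⟩, h'⟩
    refine ⟨rfl, List.append_cancel_right h, ?_⟩
    grind
  · rintro ⟨rfl, h, h'⟩
    exact ⟨⟨rfl, by rw [h]⟩, by grind⟩

section Grammars

variable {T : Type} {N : Type}

/-- The language of a grammar symbol under an interpretation of the nonterminals. -/
def symbolLanguage (I : N → Language T) : Symbol T N → Language T
  | .terminal a => {[a]}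
  | .nonterminal n => I n

/-- The language of a sentential form under an interpretation of the nonterminals. -/
def formLanguage (I : N → Language T) (u : List (Symbol T N)) : Language T :=
  (u.map (symbolLanguage I)).prod

theorem mem_formLanguage_terminals (I : N → Language T) (w : List T) :
    w ∈ formLanguage I (w.map Symbol.terminal) := by
  induction w with
  | nil => simp [formLanguage, Language.mem_one]
  | cons a w ih =>
    have := Language.append_mem_mul (l := symbolLanguage I (.terminal a)) (a := [a]) rfl ih
    simpa [formLanguage] using this

theorem mem_formLanguage_terminal (I : N → Language T) (a : T) (w : List T) :
    w ∈ formLanguage I [.terminal a] ↔ w = [a] := by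
  simp only [formLanguage, symbolLanguage, List.map_cons, List.map_nil, List.prod_cons,
    List.prod_nil, mul_one]
  rfl

theorem mem_formLanguage_sandwich (I : N → Language T) (a b : T) (n : N) (w : List T) :
    w ∈ formLanguage I [.terminal a, .nonterminal n, .terminal b] ↔
      ∃ l ∈ I n, w = a :: (l ++ [b]) := by
  simp only [formLanguage, symbolLanguage, List.map_cons, List.map_nil, List.prod_cons,
    List.prod_nil, mul_one]
  constructor
  · rintro ⟨_, rfl, _, ⟨l, hl, _, rfl, rfl⟩, rfl⟩
    exact ⟨l, hl, rfl⟩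
  · rintro ⟨l, hl, rfl⟩
    exact ⟨[a], rfl, _, ⟨l, hl, [b], rfl, rfl⟩, rfl⟩

theorem formLanguage_le_of_derives (g : ContextFreeGrammar T) (I : g.NT → Language T)
    (hI : ∀ r ∈ g.rules, formLanguage I r.output ≤ I r.input)
    {u v : List (Symbol T g.NT)} (h : g.Derives u v) :
    formLanguage I v ≤ formLanguage I u := by
  induction h with
  | refl => exact le_rfl
  | tail _ hp ih =>
    refine le_trans ?_ ih
    obtain ⟨r, hr, hrw⟩ := hp
    obtain ⟨p, q, rfl, rfl⟩ := hrw.exists_parts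
    have := hI r hr
    simp only [formLanguage, List.map_append, List.prod_append, List.map_cons, List.map_nil,
      List.prod_singleton] at this ⊢
    exact mul_le_mul' (mul_le_mul' le_rfl this) le_rfl

theorem language_le_of_rules (g : ContextFreeGrammar T) (I : g.NT → Language T)
    (hI : ∀ r ∈ g.rules, formLanguage I r.output ≤ I r.input) :
    g.language ≤ I g.initial := by
  intro w hw
  have := formLanguage_le_of_derives g I hI hw (mem_formLanguage_terminals I w)
  simpa [formLanguage, symbolLanguage] using this

end Grammars

/-- The rules `S → ε | 0S0 | 1S1`. -/
def palRules : Finset (ContextFreeRule Bool Unit) :=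
  {⟨(), []⟩} ∪ Finset.univ.image fun a : Bool =>
    ⟨(), [.terminal a, .nonterminal (), .terminal a]⟩

theorem mem_palRules (r : ContextFreeRule Bool Unit) :
    r ∈ palRules ↔ r = ⟨(), []⟩ ∨
      ∃ a, r = ⟨(), [.terminal a, .nonterminal (), .terminal a]⟩ := by
  simp only [palRules, Finset.mem_union, Finset.mem_singleton, Finset.mem_image, Finset.mem_univ,
    true_and, eq_comm (a := r)]

/-- The grammar with the rules `palRules`. -/
def palGrammar : ContextFreeGrammar Bool where
  NT := Unit
  initial := ()
  rules := palRules

theorem palGrammar_language : palGrammar.language = (Pal : Language Bool) := by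
  apply le_antisymm
  · refine language_le_of_rules palGrammar (fun _ => Pal) ?_
    intro r hr
    rcases (mem_palRules r).1 hr with rfl | ⟨a, rfl⟩
    · rintro w rfl
      exact ⟨[], rfl⟩
    · intro w hw
      obtain ⟨l, hl, rfl⟩ := (mem_formLanguage_sandwich _ _ _ _ _).1 hw
      exact (cons_append_singleton_mem_Pal_iff a a l).2 ⟨rfl, hl⟩
  · rintro _ ⟨w, rfl⟩
    change palGrammar.Derives _ _
    induction w with
    | nil =>
      exact ContextFreeGrammar.Produces.single
        ⟨⟨(), []⟩, (mem_palRules _).2 (.inl rfl), .input_output⟩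
    | cons a w ih =>
      have h1 : palGrammar.Produces [.nonterminal ()]
          [.terminal a, .nonterminal (), .terminal a] :=
        ⟨⟨(), [.terminal a, .nonterminal (), .terminal a]⟩,
          (mem_palRules _).2 (.inr ⟨a, rfl⟩), .input_output⟩
      have h2 := (ih.append_left [.terminal a]).append_right [.terminal a]
      have h3 := h1.trans_derives h2
      simp only [List.map_append, List.map_cons, List.reverse_cons, List.cons_append,
        List.nil_append, List.append_assoc, List.map_nil] at h3 ⊢
      exact h3

/-- Nonterminals of `nonPalGrammar`. -/
inductive NonPalNT : Type
  | outer
  | middle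

instance : DecidableEq NonPalNT := fun a b => by
  cases a <;> cases b <;> first | exact isTrue rfl | exact isFalse (by nofun)

/-- The rules `S → 0S0 | 1S1 | 0A1 | 1A0 | 0 | 1`, `A → ε | 0A | 1A`. -/
def nonPalRules : Finset (ContextFreeRule Bool NonPalNT) :=
  {⟨.middle, []⟩} ∪
  (Finset.univ.image fun a : Bool => ⟨.middle, [.terminal a, .nonterminal .middle]⟩) ∪
  (Finset.univ.image fun a : Bool => ⟨.outer, [.terminal a]⟩) ∪
  (Finset.univ.image fun a : Bool =>
    ⟨.outer, [.terminal a, .nonterminal .outer, .terminal a]⟩) ∪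
  (Finset.univ.image fun a : Bool =>
    ⟨.outer, [.terminal a, .nonterminal .middle, .terminal (!a)]⟩)

theorem mem_nonPalRules (r : ContextFreeRule Bool NonPalNT) :
    r ∈ nonPalRules ↔
      (((r = ⟨.middle, []⟩ ∨ ∃ a, r = ⟨.middle, [.terminal a, .nonterminal .middle]⟩) ∨
        ∃ a, r = ⟨.outer, [.terminal a]⟩) ∨
        ∃ a, r = ⟨.outer, [.terminal a, .nonterminal .outer, .terminal a]⟩) ∨
        ∃ a, r = ⟨.outer, [.terminal a, .nonterminal .middle, .terminal (!a)]⟩ := by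
  simp only [nonPalRules, Finset.mem_union, Finset.mem_singleton, Finset.mem_image,
    Finset.mem_univ, true_and, eq_comm (a := r)]

/-- The grammar with the rules `nonPalRules`. -/
def nonPalGrammar : ContextFreeGrammar Bool where
  NT := NonPalNT
  initial := .outer
  rules := nonPalRules

theorem nonPalGrammar_derives_middle (w : List Bool) :
    nonPalGrammar.Derives [.nonterminal .middle] (w.map Symbol.terminal) := by
  induction w with
  | nil =>
    exact ContextFreeGrammar.Produces.single
      ⟨⟨.middle, []⟩, (mem_nonPalRules _).2 (.inl (.inl (.inl (.inl rfl)))), .input_output⟩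
  | cons a w ih =>
    have h1 : nonPalGrammar.Produces [.nonterminal .middle]
        [.terminal a, .nonterminal .middle] :=
      ⟨⟨.middle, [.terminal a, .nonterminal .middle]⟩,
        (mem_nonPalRules _).2 (.inl (.inl (.inl (.inr ⟨a, rfl⟩)))), .input_output⟩
    simpa using h1.trans_derives (ih.append_left [.terminal a])

theorem nonPalGrammar_derives_outer (w : List Bool) (hw : w ∉ Pal) :
    nonPalGrammar.Derives [.nonterminal .outer] (w.map Symbol.terminal) := by
  induction w using List.bidirectionalRec with
  | nil => exact absurd ⟨[], rfl⟩ hw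
  | singleton a =>
    exact ContextFreeGrammar.Produces.single
      ⟨⟨.outer, [.terminal a]⟩, (mem_nonPalRules _).2 (.inl (.inl (.inr ⟨a, rfl⟩))), .input_output⟩
  | cons_append a l b ih =>
    rw [cons_append_singleton_mem_Pal_iff, not_and] at hw
    by_cases hab : a = b
    · subst hab
      have h1 : nonPalGrammar.Produces [.nonterminal .outer]
          [.terminal a, .nonterminal .outer, .terminal a] :=
        ⟨⟨.outer, [.terminal a, .nonterminal .outer, .terminal a]⟩,
          (mem_nonPalRules _).2 (.inl (.inr ⟨a, rfl⟩)), .input_output⟩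
      have h2 := ((ih (hw rfl)).append_left [.terminal a]).append_right [.terminal a]
      simpa using h1.trans_derives h2
    · obtain rfl : b = !a := by cases a <;> cases b <;> simp_all
      have h1 : nonPalGrammar.Produces [.nonterminal .outer]
          [.terminal a, .nonterminal .middle, .terminal (!a)] :=
        ⟨⟨.outer, [.terminal a, .nonterminal .middle, .terminal (!a)]⟩,
          (mem_nonPalRules _).2 (.inr ⟨a, rfl⟩), .input_output⟩
      have h2 := ((nonPalGrammar_derives_middle l).append_left [.terminal a]).append_right
        [.terminal (!a)]
      simpa using h1.trans_derives h2

theorem nonPalGrammar_language :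
    nonPalGrammar.language = ((Palᶜ : Set (List Bool)) : Language Bool) := by
  apply le_antisymm
  · refine language_le_of_rules nonPalGrammar
      (fun | .outer => (Palᶜ : Set (List Bool)) | .middle => (Set.univ : Set (List Bool))) ?_
    intro r hr
    rcases (mem_nonPalRules r).1 hr with (((rfl | ⟨a, rfl⟩) | ⟨a, rfl⟩) | ⟨a, rfl⟩) | ⟨a, rfl⟩
    · exact fun w _ => Set.mem_univ w
    · exact fun w _ => Set.mem_univ w
    · rintro w hw hp
      obtain rfl := (mem_formLanguage_terminal _ _ _).1 hw
      simp [mem_Pal_iff] at hp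
    · intro w hw hp
      obtain ⟨l, hl, rfl⟩ := (mem_formLanguage_sandwich _ _ _ _ _).1 hw
      exact hl ((cons_append_singleton_mem_Pal_iff a a l).1 hp).2
    · intro w hw hp
      obtain ⟨l, -, rfl⟩ := (mem_formLanguage_sandwich _ _ _ _ _).1 hw
      have := ((cons_append_singleton_mem_Pal_iff a (!a) l).1 hp).1
      simp at this
  · exact fun w hw => nonPalGrammar_derives_outer w hw

namespace DPDA

variable {Q α Γ : Type}

/-- `M` reaches an accepting state from the configuration `c`. -/
def AcceptsFrom (M : DPDA Q α Γ) (c : Cfg Q α Γ) : Prop :=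
  ∃ n c', M.stepN n c = some c' ∧ c'.st ∈ M.Acc

theorem stepN_succ_of_step (M : DPDA Q α Γ) {c c' : Cfg Q α Γ} (h : M.step c = some c')
    (n : ℕ) : M.stepN (n + 1) c = M.stepN n c' := by
  simp [stepN, h]

theorem stepN_add (M : DPDA Q α Γ) (m n : ℕ) (c : Cfg Q α Γ) :
    M.stepN (m + n) c = (M.stepN m c).bind (M.stepN n) := by
  induction m generalizing c with
  | zero => simp [stepN]
  | succ m ih =>
    rw [Nat.succ_add]
    simp only [stepN]
    cases M.step c with
    | none => rfl
    | some c' => simpa using ih c'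

theorem AcceptsFrom.of_stepN {M : DPDA Q α Γ} {m : ℕ} {c c' : Cfg Q α Γ}
    (h : M.stepN m c = some c') (hc : M.AcceptsFrom c') : M.AcceptsFrom c := by
  obtain ⟨n, d, hd, ha⟩ := hc
  exact ⟨m + n, d, by rw [stepN_add, h]; exact hd, ha⟩

/-- A step consumes a prefix of the input, independently of what follows. -/
theorem step_input (M : DPDA Q α Γ) {q p : Q} {i e : List (TSym α)} {s t : List Γ}
    (h : M.step ⟨q, i, s⟩ = some ⟨p, e, t⟩) :
    ∃ w, w.length ≤ 1 ∧ i = w ++ e ∧ ∀ e', M.step ⟨q, w ++ e', s⟩ = some ⟨p, e', t⟩ := by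
  unfold step at h
  cases s with
  | nil => simp at h
  | cons a s =>
    cases hn : M.δ q none a with
    | some r =>
      simp only [hn, Option.some.injEq, Cfg.mk.injEq] at h
      obtain ⟨rfl, rfl, rfl⟩ := h
      exact ⟨[], by simp, rfl, fun e' => by simp [step, hn]⟩
    | none =>
      cases i with
      | nil => simp [hn] at h
      | cons x i =>
        cases hx : M.δ q (some x) a with
        | none => simp [hn, hx] at h
        | some r =>
          simp only [hn, hx, Option.some.injEq, Cfg.mk.injEq] at h
          obtain ⟨rfl, rfl, rfl⟩ := h
          exact ⟨[x], by simp, rfl, fun e' => by simp [step, hn, hx]⟩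

theorem stepN_input (M : DPDA Q α Γ) {n : ℕ} {q p : Q} {i e : List (TSym α)} {s t : List Γ}
    (h : M.stepN n ⟨q, i, s⟩ = some ⟨p, e, t⟩) :
    ∃ w, i = w ++ e ∧ ∀ e', M.stepN n ⟨q, w ++ e', s⟩ = some ⟨p, e', t⟩ := by
  induction n generalizing q i s with
  | zero =>
    simp only [stepN, Option.some.injEq, Cfg.mk.injEq] at h
    obtain ⟨rfl, rfl, rfl⟩ := h
    exact ⟨[], rfl, fun _ => rfl⟩
  | succ n ih =>
    obtain ⟨⟨q₁, i₁, s₁⟩, h₁, h₂⟩ := Option.bind_eq_some_iff.1 h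
    obtain ⟨w₁, -, rfl, hw₁⟩ := M.step_input h₁
    obtain ⟨w₂, rfl, hw₂⟩ := ih h₂
    refine ⟨w₁ ++ w₂, by simp, fun e' => ?_⟩
    rw [List.append_assoc, M.stepN_succ_of_step (hw₁ _), hw₂]

/-- A computation that consumes at least `i₁` passes through the moment at which exactly `i₁`
is consumed. -/
theorem stepN_exists_mid (M : DPDA Q α Γ) {n : ℕ} {q p : Q} {i₁ i₂ e : List (TSym α)}
    {s t : List Γ} (h : M.stepN n ⟨q, i₁ ++ i₂, s⟩ = some ⟨p, e, t⟩)
    (hlen : e.length ≤ i₂.length) :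
    ∃ m r u, M.stepN m ⟨q, i₁ ++ i₂, s⟩ = some ⟨r, i₂, u⟩ := by
  induction n generalizing q i₁ s with
  | zero =>
    simp only [stepN, Option.some.injEq, Cfg.mk.injEq] at h
    obtain ⟨-, rfl, -⟩ := h
    obtain rfl : i₁ = [] := by
      rw [← List.length_eq_zero_iff]
      simp at hlen
      simp [hlen]
    exact ⟨0, q, s, rfl⟩
  | succ n ih =>
    cases i₁ with
    | nil => exact ⟨0, q, s, rfl⟩
    | cons x i₁ =>
      obtain ⟨⟨q₁, j, s₁⟩, h₁, h₂⟩ := Option.bind_eq_some_iff.1 h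
      obtain ⟨w, hw, hj, -⟩ := M.step_input h₁
      have : ∃ i₃, j = i₃ ++ i₂ := by
        match w, hw, hj with
        | [], _, hj => exact ⟨x :: i₁, by simpa using hj.symm⟩
        | [y], _, hj => exact ⟨i₁, by simp at hj; exact hj.2.symm⟩
      obtain ⟨i₃, rfl⟩ := this
      obtain ⟨m, r, u, hm⟩ := ih h₂
      exact ⟨m + 1, r, u, by rw [M.stepN_succ_of_step h₁, hm]⟩

theorem step_stack_append (M : DPDA Q α Γ) {q p : Q} {i e : List (TSym α)} {t t' : List Γ}
    (h : M.step ⟨q, i, t⟩ = some ⟨p, e, t'⟩) (s : List Γ) :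
    M.step ⟨q, i, t ++ s⟩ = some ⟨p, e, t' ++ s⟩ := by
  unfold step at h
  cases t with
  | nil => simp at h
  | cons a t =>
    cases hn : M.δ q none a with
    | some r =>
      simp only [hn, Option.some.injEq, Cfg.mk.injEq] at h
      obtain ⟨rfl, rfl, rfl⟩ := h
      simp [step, hn]
    | none =>
      cases i with
      | nil => simp [hn] at h
      | cons x i =>
        cases hx : M.δ q (some x) a with
        | none => simp [hn, hx] at h
        | some r =>
          simp only [hn, hx, Option.some.injEq, Cfg.mk.injEq] at h
          obtain ⟨rfl, rfl, rfl⟩ := h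
          simp [step, hn, hx]

theorem stepN_stack_append (M : DPDA Q α Γ) {n : ℕ} {q p : Q} {i e : List (TSym α)}
    {t t' : List Γ} (h : M.stepN n ⟨q, i, t⟩ = some ⟨p, e, t'⟩) (s : List Γ) :
    M.stepN n ⟨q, i, t ++ s⟩ = some ⟨p, e, t' ++ s⟩ := by
  induction n generalizing q i t with
  | zero =>
    simp only [stepN, Option.some.injEq, Cfg.mk.injEq] at h
    obtain ⟨rfl, rfl, rfl⟩ := h
    rfl
  | succ n ih =>
    obtain ⟨⟨q₁, j, s₁⟩, h₁, h₂⟩ := Option.bind_eq_some_iff.1 h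
    rw [M.stepN_succ_of_step (M.step_stack_append h₁ s), ih h₂]

theorem step_stack_split (M : DPDA Q α Γ) {q : Q} {i : List (TSym α)} {a : Γ} {t s : List Γ}
    {c : Cfg Q α Γ} (h : M.step ⟨q, i, a :: t ++ s⟩ = some c) :
    ∃ t', M.step ⟨q, i, a :: t⟩ = some ⟨c.st, c.inp, t'⟩ ∧ c.stk = t' ++ s := by
  unfold step at h
  cases hn : M.δ q none a with
  | some r =>
    simp only [List.cons_append, hn, Option.some.injEq] at h
    subst h
    exact ⟨r.2 ++ t, by simp [step, hn], by simp⟩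
  | none =>
    cases i with
    | nil => simp [hn] at h
    | cons x i =>
      cases hx : M.δ q (some x) a with
      | none => simp [hn, hx] at h
      | some r =>
        simp only [List.cons_append, hn, hx, Option.some.injEq] at h
        subst h
        exact ⟨r.2 ++ t, by simp [step, hn, hx], by simp⟩

/-- An accepting computation from a stack `t ++ s` either never needs `s`, or first removes `t`
entirely. -/
theorem AcceptsFrom.split_stack {M : DPDA Q α Γ} {q : Q} {i : List (TSym α)} {t s : List Γ}
    (h : M.AcceptsFrom ⟨q, i, t ++ s⟩) :
    M.AcceptsFrom ⟨q, i, t⟩ ∨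
      ∃ m p e, M.stepN m ⟨q, i, t⟩ = some ⟨p, e, []⟩ ∧ M.AcceptsFrom ⟨p, e, s⟩ := by
  obtain ⟨n, c, hc, ha⟩ := h
  induction n generalizing q i t with
  | zero =>
    simp only [stepN, Option.some.injEq] at hc
    subst hc
    exact .inl ⟨0, _, rfl, ha⟩
  | succ n ih =>
    cases t with
    | nil => exact .inr ⟨0, q, i, rfl, n + 1, c, hc, ha⟩
    | cons a t =>
      obtain ⟨⟨q₁, j, s₁⟩, h₁, h₂⟩ := Option.bind_eq_some_iff.1 hc
      obtain ⟨t', ht', rfl⟩ := M.step_stack_split h₁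
      rcases ih h₂ with ⟨m, d, hd, hda⟩ | ⟨m, p, e, hm, hacc⟩
      · exact .inl ⟨m + 1, d, by rw [M.stepN_succ_of_step ht', hd], hda⟩
      · exact .inr ⟨m + 1, p, e, by rw [M.stepN_succ_of_step ht', hm], hacc⟩

theorem AcceptsFrom.stack_append {M : DPDA Q α Γ} {q : Q} {i : List (TSym α)} {t : List Γ}
    (h : M.AcceptsFrom ⟨q, i, t⟩) (s : List Γ) : M.AcceptsFrom ⟨q, i, t ++ s⟩ := by
  obtain ⟨n, ⟨p, e, t'⟩, hc, ha⟩ := h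
  exact ⟨n, _, M.stepN_stack_append hc s, ha⟩

/-- The part of the tape holding `x` and the right endmarker. -/
def tapeEnd (x : List α) : List (TSym α) := x.map TSym.ch ++ [TSym.rend]

/-- `M` can be in state `q` with stack `s` right after having consumed `¢ x`. -/
def Reaches (M : DPDA Q α Γ) (x : List α) (q : Q) (s : List Γ) : Prop :=
  ∃ n, ∀ e, M.stepN n ⟨M.q0, (TSym.lend :: x.map TSym.ch) ++ e, [M.Z0]⟩ = some ⟨q, e, s⟩

theorem init_append (M : DPDA Q α Γ) (x z : List α) :
    M.init (x ++ z) = ⟨M.q0, (TSym.lend :: x.map TSym.ch) ++ tapeEnd z, [M.Z0]⟩ := by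
  simp [init, tape, tapeEnd]

theorem Reaches.accepts {M : DPDA Q α Γ} {x : List α} {q : Q} {s : List Γ}
    (h : M.Reaches x q s) {z : List α} (hz : M.AcceptsFrom ⟨q, tapeEnd z, s⟩) :
    M.Accepts (x ++ z) := by
  obtain ⟨n, hn⟩ := h
  have := AcceptsFrom.of_stepN (hn (tapeEnd z)) hz
  rwa [← init_append] at this

theorem Accepts.reaches_or_forall {M : DPDA Q α Γ} {x z : List α} (h : M.Accepts (x ++ z)) :
    (∃ q s, M.Reaches x q s) ∨ ∀ z', M.Accepts (x ++ z') := by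
  obtain ⟨n, c, hc, ha⟩ := h
  rw [init_append] at hc
  by_cases hlen : c.inp.length ≤ (tapeEnd z).length
  · left
    obtain ⟨m, r, u, hm⟩ := M.stepN_exists_mid hc hlen
    obtain ⟨w, hw, hrun⟩ := M.stepN_input hm
    rw [← List.append_cancel_right hw] at hrun
    exact ⟨r, u, m, hrun⟩
  · right
    obtain ⟨w, hw, hrun⟩ := M.stepN_input hc
    rcases List.append_eq_append_iff.1 hw with ⟨v, -, hv⟩ | ⟨v, hv, -⟩
    · simp [hv] at hlen
    · intro z'
      refine ⟨n, ⟨c.st, v ++ tapeEnd z', c.stk⟩, ?_, ha⟩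
      rw [init_append, hv, List.append_assoc, hrun]

theorem Reaches.acceptsFrom_or_forall {M : DPDA Q α Γ} {x z : List α} {q : Q} {s : List Γ}
    (hr : M.Reaches x q s) (h : M.Accepts (x ++ z)) :
    M.AcceptsFrom ⟨q, tapeEnd z, s⟩ ∨ ∀ z', M.Accepts (x ++ z') := by
  obtain ⟨m, hm⟩ := hr
  obtain ⟨n, c, hc, ha⟩ := h
  rw [init_append] at hc
  have hm' := hm (tapeEnd z)
  rcases le_total m n with hmn | hnm
  · left
    obtain ⟨k, rfl⟩ := Nat.exists_eq_add_of_le hmn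
    rw [stepN_add, hm'] at hc
    exact ⟨k, c, hc, ha⟩
  · right
    obtain ⟨k, rfl⟩ := Nat.exists_eq_add_of_le hnm
    rw [stepN_add, hc] at hm'
    obtain ⟨v, hv, -⟩ := M.stepN_input hm'
    obtain ⟨w, hw, hrun⟩ := M.stepN_input hc
    rw [hv, ← List.append_assoc] at hw
    have hx := List.append_cancel_right hw
    intro z'
    refine ⟨n, ⟨c.st, v ++ tapeEnd z', c.stk⟩, ?_, ha⟩
    rw [init_append, hx, List.append_assoc, hrun]

/-- `M` reaches state `q` with stack `s` after `¢ x`, and no extension of `x` leads to a smaller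
stack. -/
def MinReaches (M : DPDA Q α Γ) (x : List α) (q : Q) (s : List Γ) : Prop :=
  M.Reaches x q s ∧ ∀ y p t, M.Reaches (x ++ y) p t → s.length ≤ t.length

theorem Reaches.exists_minReaches {M : DPDA Q α Γ} {x : List α} {q : Q} {s : List Γ}
    (h : M.Reaches x q s) : ∃ y p t, M.MinReaches (x ++ y) p t := by
  let H : Set ℕ := {n | ∃ y p t, M.Reaches (x ++ y) p t ∧ t.length = n}
  have hne : H.Nonempty := ⟨s.length, [], q, s, by simpa using h, rfl⟩
  obtain ⟨y, p, t, hr, hlen⟩ := Nat.sInf_mem hne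
  refine ⟨y, p, t, hr, fun y' p' t' hr' => ?_⟩
  rw [hlen]
  exact Nat.sInf_le ⟨y ++ y', p', t', by rwa [← List.append_assoc], rfl⟩

theorem Reaches.of_stepN {M : DPDA Q α Γ} {x y z : List α} {q p : Q} {s t : List Γ} {n : ℕ}
    (h : M.Reaches x q s)
    (hn : M.stepN n ⟨q, tapeEnd (y ++ z), s⟩ = some ⟨p, tapeEnd z, t⟩) :
    M.Reaches (x ++ y) p t := by
  obtain ⟨m, hm⟩ := h
  obtain ⟨w, hw, hrun⟩ := M.stepN_input hn
  obtain rfl : y.map TSym.ch = w := by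
    apply List.append_cancel_right (bs := tapeEnd z)
    rw [← hw]
    simp [tapeEnd]
  refine ⟨m + n, fun e => ?_⟩
  rw [stepN_add]
  have : (TSym.lend :: (x ++ y).map TSym.ch) ++ e =
      (TSym.lend :: x.map TSym.ch) ++ (y.map TSym.ch ++ e) := by simp
  rw [this, hm]
  exact hrun e

theorem tapeEnd_suffix {z : List α} {w e : List (TSym α)} (h : tapeEnd z = w ++ e)
    (he : e ≠ []) : ∃ y z', z = y ++ z' ∧ e = tapeEnd z' := by
  rcases List.append_eq_append_iff.1 h with ⟨v, -, hv⟩ | ⟨v, hv, rfl⟩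
  · refine ⟨z, [], by simp, ?_⟩
    have : v = [] := by
      rcases List.singleton_eq_append_iff.1 hv with h | h
      · exact h.1
      · exact absurd h.2 he
    subst this
    simpa [tapeEnd] using hv.symm
  · obtain ⟨y, z', rfl, -, rfl⟩ := List.map_eq_append_iff.1 hv
    exact ⟨y, z', rfl, rfl⟩

/-- From a configuration of minimal stack height, acceptance depends only on the state, the
topmost stack symbol, and the way the rest of the stack is treated at the end of the input. -/
theorem MinReaches.acceptsFrom_transfer {M : DPDA Q α Γ} {x z : List α} {q : Q} {s s' : List Γ}
    (hr : M.MinReaches x q s) (hhead : s.head? = s'.head?)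
    (htail : ∀ p, M.AcceptsFrom ⟨p, [], s.tail⟩ → M.AcceptsFrom ⟨p, [], s'.tail⟩)
    (h : M.AcceptsFrom ⟨q, tapeEnd z, s⟩) : M.AcceptsFrom ⟨q, tapeEnd z, s'⟩ := by
  cases s with
  | nil =>
    cases s' with
    | nil => exact h
    | cons b s' => simp at hhead
  | cons a s =>
    cases s' with
    | nil => simp at hhead
    | cons b s' =>
      obtain rfl : a = b := by simpa using hhead
      simp only [List.tail_cons] at htail
      rcases AcceptsFrom.split_stack (t := [a]) h with hacc | ⟨m, p, e, hm, hacc⟩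
      · exact hacc.stack_append s'
      · obtain rfl : e = [] := by
          by_contra he
          obtain ⟨w, hw, -⟩ := M.stepN_input hm
          obtain ⟨y, z', rfl, rfl⟩ := tapeEnd_suffix hw he
          have := hr.2 y p s (hr.1.of_stepN (M.stepN_stack_append hm s))
          simp at this
        exact AcceptsFrom.of_stepN (M.stepN_stack_append hm s') (htail p hacc)

end DPDA

theorem prefix_of_append_mem_Pal {x z : List Bool} (h : x ++ z ∈ Pal)
    (hlen : x.length ≤ z.length) : x <+: z.reverse := by
  have hrev := ((mem_Pal_iff _).1 h).1
  rw [List.reverse_append] at hrev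
  exact List.prefix_of_prefix_length_le ⟨z, rfl⟩ (hrev ▸ List.prefix_append _ _) (by simpa)

theorem not_forall_append_mem_Pal (x : List Bool) : ¬ ∀ z, x ++ z ∈ Pal := by
  intro h
  have h0 := ((mem_Pal_iff _).1 (h [])).2
  have h1 := ((mem_Pal_iff _).1 (h [true])).2
  simp only [List.length_append, List.length_nil, List.length_singleton] at h0 h1
  grind

theorem eq_of_replicate_prefix {m n : ℕ} {u v : List Bool}
    (h : List.replicate m false ++ true :: u <+: List.replicate n false ++ true :: v) :
    m = n := by
  induction m generalizing n with
  | zero => cases n <;> simp_all [List.replicate_succ]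
  | succ m ih =>
    cases n with
    | zero => simp [List.replicate_succ] at h
    | succ n =>
      simp only [List.replicate_succ, List.cons_append, List.cons_prefix_cons, true_and] at h
      rw [ih h]

/-- Every string has an extension that a given dcf sublanguage of `Pal` no longer completes to
long words. -/
theorem IsDCFL.exists_append_notMem {L : Set (List Bool)} (hL : IsDCFL L) (hsub : L ⊆ Pal)
    (x : List Bool) : ∃ y, ∃ N : ℕ, ∀ z : List Bool, N ≤ z.length → x ++ y ++ z ∉ L := by
  obtain ⟨Q, Γ, _, _, M, -, -, rfl⟩ := hL
  by_contra! hcon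
  have hnot : ∀ y, ¬ ∀ z, M.Accepts (x ++ y ++ z) := fun y h =>
    not_forall_append_mem_Pal (x ++ y) fun z => hsub (h z)
  have hex : ∀ m : ℕ, ∃ y q s,
      M.MinReaches (x ++ (List.replicate m false ++ true :: y)) q s := by
    intro m
    obtain ⟨z, -, hz⟩ := hcon (List.replicate m false ++ [true]) 0
    obtain ⟨q, s, hr⟩ := (DPDA.Accepts.reaches_or_forall hz).resolve_right (hnot _)
    obtain ⟨y, p, t, ht⟩ := hr.exists_minReaches
    exact ⟨y, p, t, by simpa using ht⟩
  choose y q s hmin using hex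
  let f : ℕ → Q × Option Γ × Set Q := fun m =>
    (q m, (s m).head?, {p | M.AcceptsFrom ⟨p, [], (s m).tail⟩})
  obtain ⟨m, n, hmn, hf⟩ := Finite.exists_ne_map_eq_of_infinite f
  simp only [f, Prod.mk.injEq] at hf
  obtain ⟨hq, hhead, hset⟩ := hf
  set u := List.replicate m false ++ true :: y m
  set v := List.replicate n false ++ true :: y n
  obtain ⟨z, hlen, hz⟩ := hcon u (max (x ++ u).length (x ++ v).length)
  have hacc := ((hmin m).1.acceptsFrom_or_forall hz).resolve_right (hnot u)
  have hacc' := (hmin m).acceptsFrom_transfer hhead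
    (fun p hp => (Set.ext_iff.1 hset p).1 hp) hacc
  rw [hq] at hacc'
  have hz' : M.Accepts (x ++ v ++ z) := (hmin n).1.accepts hacc'
  have h₁ := prefix_of_append_mem_Pal (hsub hz) ((le_max_left _ _).trans hlen)
  have h₂ := prefix_of_append_mem_Pal (hsub hz') ((le_max_right _ _).trans hlen)
  rcases List.prefix_or_prefix_of_prefix h₁ h₂ with h | h
  · exact hmn (eq_of_replicate_prefix ((List.prefix_append_right_inj x).1 h))
  · exact hmn (eq_of_replicate_prefix ((List.prefix_append_right_inj x).1 h)).symm

theorem not_DCFLUnion_Pal (d : ℕ) : ¬ DCFLUnion d Pal := by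
  rintro ⟨f, hf, hPal⟩
  have key : ∀ S : Finset (Fin d), ∃ x, ∃ N : ℕ, ∀ i ∈ S, ∀ z : List Bool, N ≤ z.length →
      x ++ z ∉ f i := by
    intro S
    induction S using Finset.induction_on with
    | empty => exact ⟨[], 0, by simp⟩
    | insert i S _ ih =>
      obtain ⟨x, N, hx⟩ := ih
      have hsub : f i ⊆ Pal := hPal ▸ Set.subset_iUnion f i
      obtain ⟨y, N', hy⟩ := (hf i).exists_append_notMem hsub x
      refine ⟨x ++ y, max N N', fun j hj z hz => ?_⟩
      rcases Finset.mem_insert.1 hj with rfl | hj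
      · exact hy z ((le_max_right _ _).trans hz)
      · rw [List.append_assoc]
        refine hx j hj _ ?_
        rw [List.length_append]
        exact ((le_max_left _ _).trans hz).trans (Nat.le_add_left _ _)
  obtain ⟨x, N, hx⟩ := key Finset.univ
  let t := List.replicate N true
  have hmem : x ++ (t ++ (x ++ t).reverse) ∈ Pal := ⟨x ++ t, by simp⟩
  rw [hPal] at hmem
  obtain ⟨i, hi⟩ := Set.mem_iUnion.1 hmem
  exact hx i (Finset.mem_univ i) _ (by simp [t]) hi

/-- `Pal` is context-free, its complement is context-free, but `Pal ∉ DCFL[d]`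
for every `d ≥ 1` (hence `Pal ∉ DCFL[ω]`). -/
theorem Pal_in_CFL_cap_coCFL_not_in_DCFLUnion :
    Language.IsContextFree (Pal : Language Bool) ∧
    Language.IsContextFree ((Palᶜ : Set (List Bool)) : Language Bool) ∧
    ∀ d : ℕ, 1 ≤ d → ¬ DCFLUnion d Pal := by
  exact ⟨⟨palGrammar, palGrammar_language⟩, ⟨nonPalGrammar, nonPalGrammar_language⟩,
    fun d _ => not_DCFLUnion_Pal d⟩

end DCFLFormal
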